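/- (Meier's lemma, quenching part.) Let c, α > 0 and suppose f(s) ≤ c s^{1+α} for all s ≥ 0. Let Φ be a bounded nonnegative classical solution of Φ_t = ΔΦ + u·∇Φ with initial datum Φ₀ ≥ 0, and set I := ∫₀^∞ (sup_{x∈ℝ^N} Φ(t,x))^α dt. If I < ∞ and 0 ≤ δ₀ < (cαI)^{−1/α}, then every classical solution T of T_t = ΔT + u·∇T + f(T) with initial datum T₀ = δ₀ Φ₀ quenches, i.e., lim_{t→∞} sup_x T(t,x) = 0. -/

import Mathlib

open MeasureTheory
open scoped BigOperators

noncomputable section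

/-- Partial derivative of `g : ℝ^N → ℝ` in the `i`-th coordinate direction. -/
def pd {N : ℕ} (i : Fin N) (g : (Fin N → ℝ) → ℝ) (z : Fin N → ℝ) : ℝ :=
  fderiv ℝ g z (Pi.single i 1)

/-- Laplacian of `g : ℝ^N → ℝ`. -/
def lap {N : ℕ} (g : (Fin N → ℝ) → ℝ) (z : Fin N → ℝ) : ℝ :=
  ∑ i, pd i (pd i g) z

/-- A classical solution of `T_t = ΔT + u·∇T + f(T)` on `ℝ^N`: continuous on
`[0,∞)×ℝ^N`, nonnegative, bounded on `[0,τ]×ℝ^N` for every `τ > 0`, `C¹` in `t` and `C²`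
in `x` for `t > 0`, satisfying the equation pointwise for `t > 0` and `T(0,·) = T₀`. -/
structure IsRDSol (N : ℕ) (u : (Fin N → ℝ) → Fin N → ℝ) (f : ℝ → ℝ)
    (T0 : (Fin N → ℝ) → ℝ) (T : ℝ → (Fin N → ℝ) → ℝ) : Prop where
  cont : ContinuousOn (fun p : ℝ × (Fin N → ℝ) => T p.1 p.2) {p | 0 ≤ p.1}
  nonneg : ∀ t z, 0 ≤ t → 0 ≤ T t z
  bddOnCompactTime : ∀ τ : ℝ, 0 < τ → ∃ C : ℝ, ∀ t z, 0 ≤ t → t ≤ τ → T t z ≤ C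
  timeDiff : ∀ t z, 0 < t → DifferentiableAt ℝ (fun s => T s z) t
  spaceC2 : ∀ t, 0 < t → ContDiff ℝ 2 (T t)
  eqn : ∀ t z, 0 < t →
    deriv (fun s => T s z) t
      = lap (T t) z + (∑ i, u z i * pd i (T t) z) + f (T t z)
  init : ∀ z, T 0 z = T0 z

/-- `T` quenches: `lim_{t→∞} sup_{x} T(t,x) = 0` (for nonnegative `T`). -/
def RDQuenches (N : ℕ) (T : ℝ → (Fin N → ℝ) → ℝ) : Prop :=
  ∀ ε > (0:ℝ), ∃ t₀ : ℝ, ∀ t ≥ t₀, ∀ z, T t z ≤ ε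

open Set Filter Topology

section DifferentialOperator

variable {N : ℕ}

/-- The operator `g ↦ Δg + u·∇g`. -/
def driftLap (u : (Fin N → ℝ) → Fin N → ℝ) (g : (Fin N → ℝ) → ℝ) (z : Fin N → ℝ) : ℝ :=
  lap g z + ∑ i, u z i * pd i g z

lemma pd_sub_const_mul (i : Fin N) {g h : (Fin N → ℝ) → ℝ} (hg : Differentiable ℝ g)
    (hh : Differentiable ℝ h) (b : ℝ) :
    pd i (fun z => g z - b * h z) = fun z => pd i g z - b * pd i h z := by
  funext z
  have := ((hg z).hasFDerivAt.sub ((hh z).hasFDerivAt.const_mul b)).fderiv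
  unfold pd
  erw [this]
  simp

lemma differentiable_pd (i : Fin N) {g : (Fin N → ℝ) → ℝ} (hg : ContDiff ℝ 2 g) :
    Differentiable ℝ (pd i g) := by
  have h1 : ContDiff ℝ 1 (fderiv ℝ g) := hg.fderiv_right (by norm_num)
  exact (h1.differentiable (by norm_num)).clm_apply (differentiable_const _)

lemma driftLap_sub_const_mul (u : (Fin N → ℝ) → Fin N → ℝ) {g h : (Fin N → ℝ) → ℝ}
    (hg : ContDiff ℝ 2 g) (hh : ContDiff ℝ 2 h) (b : ℝ) (z : Fin N → ℝ) :
    driftLap u (fun z => g z - b * h z) z = driftLap u g z - b * driftLap u h z := by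
  have hg1 := hg.differentiable (by norm_num)
  have hh1 := hh.differentiable (by norm_num)
  simp only [driftLap, lap, pd_sub_const_mul _ hg1 hh1,
    pd_sub_const_mul _ (differentiable_pd _ hg) (differentiable_pd _ hh),
    Finset.sum_sub_distrib, mul_sub, ← Finset.mul_sum, mul_add]
  have : ∑ i, u z i * (b * pd i h z) = b * ∑ i, u z i * pd i h z := by
    rw [Finset.mul_sum]
    exact Finset.sum_congr rfl fun i _ => by ring
  rw [this]
  ring

lemma deriv_deriv_nonpos_of_isLocalMax {φ : ℝ → ℝ} {x : ℝ} (hφ : ContinuousAt φ x)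
    (hmax : IsLocalMax φ x) : deriv (deriv φ) x ≤ 0 := by
  by_contra! hpos
  have hmin : IsLocalMin φ x :=
    isLocalMin_of_deriv_deriv_pos hpos hmax.deriv_eq_zero hφ
  have hconst : φ =ᶠ[𝓝 x] fun _ => φ x := by
    filter_upwards [hmin, hmax] with y h1 h2 using le_antisymm h2 h1
  have : deriv (deriv φ) x = 0 := by
    rw [hconst.deriv.deriv_eq]
    simp
  linarith

lemma pd_pd_nonpos_of_isLocalMax (i : Fin N) {h : (Fin N → ℝ) → ℝ} (hh : ContDiff ℝ 2 h)
    {z : Fin N → ℝ} (hmax : IsLocalMax h z) : pd i (pd i h) z ≤ 0 := by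
  have hline : ∀ r : ℝ, HasDerivAt (fun r : ℝ => z + r • (Pi.single i 1 : Fin N → ℝ))
      (Pi.single i 1) r := fun r => by
    simpa using ((hasDerivAt_id r).smul_const (Pi.single i 1 : Fin N → ℝ)).const_add z
  have hcomp : ∀ {g : (Fin N → ℝ) → ℝ}, Differentiable ℝ g → ∀ r : ℝ,
      HasDerivAt (fun r : ℝ => g (z + r • (Pi.single i 1 : Fin N → ℝ)))
        (pd i g (z + r • (Pi.single i 1 : Fin N → ℝ))) r := fun hg r =>
    (hg _).hasFDerivAt.comp_hasDerivAt r (hline r)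
  have hd := hh.differentiable (by norm_num)
  have h1 : deriv (fun r : ℝ => h (z + r • (Pi.single i 1 : Fin N → ℝ)))
      = fun r => pd i h (z + r • (Pi.single i 1 : Fin N → ℝ)) :=
    funext fun r => (hcomp hd r).deriv
  have h2 := (hcomp (differentiable_pd i hh) 0).deriv
  have hmax' : IsLocalMax (fun r : ℝ => h (z + r • (Pi.single i 1 : Fin N → ℝ))) 0 := by
    have ht : Tendsto (fun r : ℝ => z + r • (Pi.single i 1 : Fin N → ℝ)) (𝓝 0) (𝓝 z) := by
      simpa using (hline 0).continuousAt.tendsto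
    simpa [IsLocalMax, IsMaxFilter] using ht.eventually hmax
  have h3 := deriv_deriv_nonpos_of_isLocalMax (hcomp hd 0).continuousAt hmax'
  rw [h1, h2] at h3
  simpa using h3

lemma driftLap_nonpos_of_isLocalMax (u : (Fin N → ℝ) → Fin N → ℝ) {h : (Fin N → ℝ) → ℝ}
    (hh : ContDiff ℝ 2 h) {z : Fin N → ℝ} (hmax : IsLocalMax h z) : driftLap u h z ≤ 0 := by
  have h1 : ∀ i, pd i h z = 0 := fun i => by simp [pd, hmax.fderiv_eq_zero]
  simp only [driftLap, h1, mul_zero, Finset.sum_const_zero, add_zero]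
  exact Finset.sum_nonpos fun i _ => pd_pd_nonpos_of_isLocalMax i hh hmax

/-- The weight `1 + |z|²`. -/
def quadWeight (z : Fin N → ℝ) : ℝ := 1 + ∑ i, z i ^ 2

lemma one_le_quadWeight (z : Fin N → ℝ) : 1 ≤ quadWeight z := by
  have : 0 ≤ ∑ i, z i ^ 2 := Finset.sum_nonneg fun i _ => sq_nonneg _
  unfold quadWeight
  linarith

lemma contDiff_quadWeight : ContDiff ℝ 2 (quadWeight (N := N)) := by
  unfold quadWeight
  fun_prop

lemma sq_norm_le_quadWeight (z : Fin N → ℝ) : ‖z‖ ^ 2 ≤ quadWeight z := by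
  have hq := one_le_quadWeight z
  have : ‖z‖ ≤ √(quadWeight z) := by
    refine (pi_norm_le_iff_of_nonneg (Real.sqrt_nonneg _)).2 fun i => ?_
    refine Real.abs_le_sqrt ?_
    have := Finset.single_le_sum (f := fun i => z i ^ 2) (fun i _ => sq_nonneg _)
      (Finset.mem_univ i)
    unfold quadWeight
    linarith
  calc ‖z‖ ^ 2 ≤ √(quadWeight z) ^ 2 := by gcongr
    _ = quadWeight z := Real.sq_sqrt (by linarith)

lemma pd_quadWeight (i : Fin N) : pd i (quadWeight (N := N)) = fun z => 2 * z i := by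
  funext z
  have h : HasFDerivAt (quadWeight (N := N))
      (∑ j, (2 * z j) • (ContinuousLinearMap.proj j : (Fin N → ℝ) →L[ℝ] ℝ)) z := by
    unfold quadWeight
    refine (HasFDerivAt.fun_sum fun j _ => ?_).const_add 1
    simpa using (hasFDerivAt_apply (𝕜 := ℝ) j z).pow 2
  simp [pd, h.fderiv, Pi.single_apply]

lemma pd_pd_quadWeight (i : Fin N) (z : Fin N → ℝ) : pd i (pd i quadWeight) z = 2 := by
  have h := (hasFDerivAt_apply (𝕜 := ℝ) i z).const_mul 2
  rw [pd_quadWeight, pd, h.fderiv]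
  simp

lemma driftLap_quadWeight_le {u : (Fin N → ℝ) → Fin N → ℝ} {U : ℝ} (hu : ∀ z, ‖u z‖ ≤ U)
    (z : Fin N → ℝ) : driftLap u quadWeight z ≤ (2 * N + U * (N + 1)) * quadWeight z := by
  have hU : 0 ≤ U := (norm_nonneg _).trans (hu z)
  have hq := one_le_quadWeight z
  have h1 : ∑ i, u z i * (2 * z i) ≤ ∑ i, U * (1 + z i ^ 2) := by
    refine Finset.sum_le_sum fun i _ => ?_
    have h2 : |u z i| ≤ U := (norm_le_pi_norm (u z) i).trans (hu z)
    have h3 : |2 * z i| ≤ 1 + z i ^ 2 := by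
      rw [abs_le]
      constructor <;> nlinarith [sq_nonneg (z i + 1), sq_nonneg (z i - 1)]
    calc u z i * (2 * z i) ≤ |u z i| * |2 * z i| := by
          rw [← abs_mul]
          exact le_abs_self _
      _ ≤ U * (1 + z i ^ 2) := by gcongr
  have h4 : ∑ i, U * (1 + z i ^ 2) = U * (N + (quadWeight z - 1)) := by
    rw [← Finset.mul_sum, Finset.sum_add_distrib]
    simp [quadWeight]
  simp only [driftLap, lap, pd_pd_quadWeight]
  simp only [pd_quadWeight, Finset.sum_const, Finset.card_univ, Fintype.card_fin, nsmul_eq_mul]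
  have hN : (0 : ℝ) ≤ N := Nat.cast_nonneg N
  nlinarith [mul_nonneg hU hN, mul_nonneg (mul_nonneg hU hN) (sub_nonneg.2 hq),
    mul_nonneg hN (sub_nonneg.2 hq)]

lemma driftLap_le_of_le_quadWeight {u : (Fin N → ℝ) → Fin N → ℝ} {U : ℝ}
    (hu : ∀ z, ‖u z‖ ≤ U) {g : (Fin N → ℝ) → ℝ} (hg : ContDiff ℝ 2 g) {κ : ℝ} (hκ : 0 ≤ κ)
    (hle : ∀ y, g y ≤ κ * quadWeight y) {z : Fin N → ℝ} (heq : g z = κ * quadWeight z) :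
    driftLap u g z ≤ (2 * N + U * (N + 1)) * g z := by
  have hmax : IsLocalMax (fun y => g y - κ * quadWeight y) z :=
    Eventually.of_forall fun y => by
      have := hle y
      simp only [heq]
      linarith
  have h1 := driftLap_nonpos_of_isLocalMax u
    (hg.sub (contDiff_const.mul contDiff_quadWeight)) hmax
  rw [driftLap_sub_const_mul u hg contDiff_quadWeight] at h1
  have h2 := mul_le_mul_of_nonneg_left (driftLap_quadWeight_le hu z) hκ
  rw [heq]
  linarith

end DifferentialOperator

section MaximumPrinciple

variable {N : ℕ}

/-- A function bounded above on `[0,τ] × ℝ^N`, nonpositive at time `0` and positive somewhere,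
is touched from above by a positive multiple of `e^{λt}(1 + |z|²)` at a positive time. -/
lemma exists_touching {w : ℝ → (Fin N → ℝ) → ℝ} {τ C : ℝ} (lam : ℝ)
    (hw : ContinuousOn (fun p : ℝ × (Fin N → ℝ) => w p.1 p.2) (Icc 0 τ ×ˢ univ))
    (hC : ∀ t ∈ Icc 0 τ, ∀ z, w t z ≤ C) (h0 : ∀ z, w 0 z ≤ 0)
    {t₁ : ℝ} (ht₁ : t₁ ∈ Icc 0 τ) {z₁ : Fin N → ℝ} (hpos : 0 < w t₁ z₁) :
    ∃ t ∈ Ioc 0 τ, ∃ z, ∃ q > 0,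
      (∀ s ∈ Icc 0 τ, ∀ y, w s y ≤ q * Real.exp (lam * s) * quadWeight y) ∧
      w t z = q * Real.exp (lam * t) * quadWeight z := by
  have hqw : ∀ y : Fin N → ℝ, 0 < quadWeight y := fun y => by linarith [one_le_quadWeight y]
  let d : ℝ × (Fin N → ℝ) → ℝ := fun p => Real.exp (lam * p.1) * quadWeight p.2
  have hd : ∀ p, 0 < d p := fun p => mul_pos (Real.exp_pos _) (hqw _)
  have hdc : Continuous d :=
    (Real.continuous_exp.comp (continuous_const.mul continuous_fst)).mul
      (contDiff_quadWeight.continuous.comp continuous_snd)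
  let Q : ℝ × (Fin N → ℝ) → ℝ := fun p => w p.1 p.2 / d p
  have hQ : ContinuousOn Q (Icc 0 τ ×ˢ univ) :=
    hw.div hdc.continuousOn fun p _ => (hd p).ne'
  have hQ1 : 0 < Q (t₁, z₁) := div_pos hpos (hd _)
  have hCpos : 0 < C := hpos.trans_le (hC t₁ ht₁ z₁)
  let A : ℝ := C * Real.exp (|lam| * τ) / Q (t₁, z₁)
  have hA : 0 < A := by positivity
  have hfar : ∀ s ∈ Icc 0 τ, ∀ y, Q (t₁, z₁) ≤ Q (s, y) → ‖y‖ ≤ √A := by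
    intro s hs y hle
    refine Real.le_sqrt_of_sq_le ((sq_norm_le_quadWeight y).trans ?_)
    rw [le_div_iff₀ hQ1]
    have hle' : Q (t₁, z₁) * d (s, y) ≤ C := by
      rw [← le_div_iff₀ (hd _)]
      exact hle.trans (div_le_div_of_nonneg_right (hC s hs y) (hd _).le)
    have he : 1 ≤ Real.exp (|lam| * τ) * Real.exp (lam * s) := by
      rw [← Real.exp_add, Real.one_le_exp_iff]
      have h1 : |lam| * s ≤ |lam| * τ := mul_le_mul_of_nonneg_left hs.2 (abs_nonneg _)
      have h2 : -|lam| * s ≤ lam * s := mul_le_mul_of_nonneg_right (neg_abs_le _) hs.1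
      linarith
    calc quadWeight y * Q (t₁, z₁)
        ≤ (Real.exp (|lam| * τ) * Real.exp (lam * s)) * (quadWeight y * Q (t₁, z₁)) :=
          le_mul_of_one_le_left (mul_pos (hqw y) hQ1).le he
      _ = (Q (t₁, z₁) * d (s, y)) * Real.exp (|lam| * τ) := by
          simp only [d]
          ring
      _ ≤ C * Real.exp (|lam| * τ) := by gcongr
  obtain ⟨⟨t, z⟩, ⟨ht, -⟩, hmax⟩ :=
    (isCompact_Icc.prod (isCompact_closedBall (0 : Fin N → ℝ) (√A))).exists_isMaxOn
      (f := Q) ⟨(t₁, z₁), ht₁, by simpa using hfar t₁ ht₁ z₁ le_rfl⟩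
      (hQ.mono (prod_mono_right (subset_univ _)))
  have hge : Q (t₁, z₁) ≤ Q (t, z) :=
    hmax (show (t₁, z₁) ∈ _ from ⟨ht₁, by simpa using hfar t₁ ht₁ z₁ le_rfl⟩)
  have hglob : ∀ s ∈ Icc 0 τ, ∀ y, Q (s, y) ≤ Q (t, z) := by
    intro s hs y
    by_cases h : Q (t₁, z₁) ≤ Q (s, y)
    · exact hmax (show (s, y) ∈ _ from ⟨hs, by simpa using hfar s hs y h⟩)
    · exact (not_le.1 h).le.trans hge
  have hqpos : 0 < Q (t, z) := hQ1.trans_le hge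
  have hwpos : 0 < w t z := (div_pos_iff_of_pos_right (hd (t, z))).1 hqpos
  have htpos : 0 < t := by
    refine lt_of_le_of_ne ht.1 fun h => ?_
    subst h
    exact absurd hwpos (not_lt.2 (h0 z))
  refine ⟨t, ⟨htpos, ht.2⟩, z, Q (t, z), hqpos, fun s hs y => ?_, ?_⟩
  · have := (div_le_iff₀ (hd (s, y))).1 (hglob s hs y)
    rw [mul_assoc]
    exact this
  · rw [mul_assoc]
    exact (div_mul_cancel₀ _ (hd (t, z)).ne').symm

lemma deriv_nonneg_of_forall_le_left {φ : ℝ → ℝ} {a t φ' : ℝ} (hat : a < t)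
    (hφ : HasDerivAt φ φ' t) (hle : ∀ s ∈ Icc a t, φ s ≤ φ t) : 0 ≤ φ' := by
  have h := hφ.hasDerivWithinAt (s := Iio t)
  rw [hasDerivWithinAt_iff_tendsto_slope' (by simp)] at h
  refine ge_of_tendsto h ?_
  have : Ioo a t ∈ 𝓝[<] t := Ioo_mem_nhdsLT hat
  filter_upwards [this] with s hs
  rw [slope_def_field]
  exact div_nonneg_of_nonpos (by linarith [hle s ⟨hs.1.le, hs.2.le⟩]) (by linarith [hs.2])

/-- Solutions of the linear equation lie below every constant which bounds them at an earlier
time. -/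
lemma IsRDSol.le_of_le {u : (Fin N → ℝ) → Fin N → ℝ} {U : ℝ} (hu : ∀ z, ‖u z‖ ≤ U)
    {Φ0 : (Fin N → ℝ) → ℝ} {Φ : ℝ → (Fin N → ℝ) → ℝ} (hΦ : IsRDSol N u (fun _ => 0) Φ0 Φ)
    {s M : ℝ} (hs : 0 ≤ s) (hM : ∀ z, Φ s z ≤ M) {t : ℝ} (hst : s ≤ t) (z : Fin N → ℝ) :
    Φ t z ≤ M := by
  by_contra! hlt
  have htpos : 0 < t := by
    rcases hst.eq_or_lt with rfl | h
    · exact absurd hlt (not_lt.2 (hM z))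
    · linarith
  obtain ⟨C, hC⟩ := hΦ.bddOnCompactTime t htpos
  have hcont : ContinuousOn (fun p : ℝ × (Fin N → ℝ) => Φ (s + p.1) p.2 - M)
      (Icc 0 (t - s) ×ˢ univ) := by
    refine ContinuousOn.sub ?_ continuousOn_const
    refine hΦ.cont.comp (f := fun p : ℝ × (Fin N → ℝ) => (s + p.1, p.2))
      (by fun_prop) fun p hp => ?_
    exact add_nonneg hs hp.1.1
  obtain ⟨r, hr, y, q, hq, hle, heq⟩ := exists_touching (2 * N + U * (N + 1) + 1)
    (w := fun r z => Φ (s + r) z - M) (τ := t - s) (C := C - M) hcont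
    (fun r hr z => by
      have := hC (s + r) z (add_nonneg hs hr.1) (by linarith [hr.2])
      linarith)
    (fun z => by simpa using hM z) (t₁ := t - s) ⟨by linarith, le_rfl⟩ (z₁ := z)
    (by simpa using hlt)
  set K : ℝ := 2 * N + U * (N + 1)
  have hsr : 0 < s + r := by linarith [hr.1]
  have hκ : 0 ≤ q * Real.exp ((K + 1) * r) := by positivity
  have hgpos : 0 < Φ (s + r) y - M := by
    rw [heq]
    have := one_le_quadWeight y
    positivity
  have hspace := driftLap_le_of_le_quadWeight hu
    ((hΦ.spaceC2 _ hsr).sub contDiff_const) hκ (hle r ⟨hr.1.le, hr.2⟩) heq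
  have hlin : driftLap u (fun y => Φ (s + r) y - M) y = driftLap u (Φ (s + r)) y := by
    have h1 : driftLap u (fun _ => M) y = 0 := by
      have h0 : ∀ (i : Fin N) (a : ℝ), pd i (fun _ => a) = fun _ => 0 := fun i a => by
        funext x
        simp [pd]
      simp [driftLap, lap, h0]
    have h2 := driftLap_sub_const_mul u (hΦ.spaceC2 _ hsr) (contDiff_const (c := M)) 1 y
    simpa [h1] using h2
  have hderiv := (hΦ.timeDiff (s + r) y hsr).hasDerivAt
  rw [hΦ.eqn _ y hsr, add_zero] at hderiv
  have htime := (hderiv.comp_const_add s r).sub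
    (((((hasDerivAt_id r).const_mul (K + 1)).exp).const_mul q).mul_const (quadWeight y))
  have hnn := deriv_nonneg_of_forall_le_left hr.1 htime (fun x hx => by
    have h1 := hle x ⟨hx.1, hx.2.trans hr.2⟩ y
    simp only [id, Pi.sub_apply] at *
    linarith)
  change 0 ≤ driftLap u (Φ (s + r)) y - _ at hnn
  rw [← hlin] at hnn
  simp only [id, mul_one] at hnn
  have : q * (Real.exp ((K + 1) * r) * (K + 1)) * quadWeight y
      = (K + 1) * (Φ (s + r) y - M) := by
    rw [heq]
    ring
  rw [this] at hnn
  change driftLap u (fun y => Φ (s + r) y - M) y ≤ K * (Φ (s + r) y - M) at hspace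
  linarith

/-- Comparison of `T` with the supersolution `G^{-1/α} Φ`, where `G` decreases at least at the
rate `cα m` and `m` dominates `Φ^α`. -/
lemma IsRDSol.le_rpow_mul {u : (Fin N → ℝ) → Fin N → ℝ} {U : ℝ} (hu : ∀ z, ‖u z‖ ≤ U)
    {f : ℝ → ℝ} (hf_locLip : ∀ R : ℝ, 0 < R → ∃ K, LipschitzOnWith K f (Icc 0 R))
    {c α : ℝ} (hc : 0 < c) (hα : 0 < α) (hf_le : ∀ s : ℝ, 0 ≤ s → f s ≤ c * s ^ (1 + α))
    {Φ0 T0 : (Fin N → ℝ) → ℝ} {Φ T : ℝ → (Fin N → ℝ) → ℝ}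
    (hΦ : IsRDSol N u (fun _ => 0) Φ0 Φ) (hT : IsRDSol N u f T0 T)
    {m G : ℝ → ℝ} (hm : ∀ t z, 0 < t → Φ t z ^ α ≤ m t)
    {τ : ℝ} (hGpos : ∀ t ∈ Icc 0 τ, 0 < G t) (hGc : ContinuousOn G (Icc 0 τ))
    (hG : ∀ t ∈ Icc 0 τ, 0 < t → ∀ s ∈ Icc 0 t, G t + c * α * m t * (t - s) ≤ G s)
    (hinit : ∀ z, T0 z ≤ G 0 ^ (-(1 / α)) * Φ0 z)
    (hτ : 0 < τ) (z : Fin N → ℝ) : T τ z ≤ G τ ^ (-(1 / α)) * Φ τ z := by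
  by_contra! hlt
  obtain ⟨C, hC⟩ := hT.bddOnCompactTime τ hτ
  obtain ⟨L, hL⟩ := hf_locLip (max C 1) (by positivity)
  have hsub : (Icc 0 τ ×ˢ univ : Set (ℝ × (Fin N → ℝ))) ⊆ {p | 0 ≤ p.1} :=
    fun p hp => hp.1.1
  have hcont : ContinuousOn
      (fun p : ℝ × (Fin N → ℝ) => T p.1 p.2 - G p.1 ^ (-(1 / α)) * Φ p.1 p.2)
      (Icc 0 τ ×ˢ univ) := by
    refine (hT.cont.mono hsub).sub (ContinuousOn.mul ?_ (hΦ.cont.mono hsub))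
    refine ContinuousOn.rpow_const ?_ fun p hp => Or.inl (hGpos p.1 hp.1).ne'
    exact hGc.comp continuousOn_fst fun p hp => hp.1
  obtain ⟨t, ht, y, q, hq, hle, heq⟩ := exists_touching (2 * N + U * (N + 1) + L + 1)
    (w := fun t z => T t z - G t ^ (-(1 / α)) * Φ t z) (C := C) hcont
    (fun t ht z => by
      have h1 := hC t z ht.1 ht.2
      have h2 := mul_nonneg (Real.rpow_nonneg (hGpos t ht).le (-(1 / α))) (hΦ.nonneg t z ht.1)
      linarith)
    (fun z => by
      have := hinit z
      rw [hT.init, hΦ.init]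
      linarith) (t₁ := τ) ⟨hτ.le, le_rfl⟩ (z₁ := z) (by simpa using hlt)
  set K : ℝ := 2 * N + U * (N + 1)
  have htI : t ∈ Icc 0 τ := ⟨ht.1.le, ht.2⟩
  set β : ℝ := G t ^ (-(1 / α)) with hβ
  have hβ0 : 0 < β := Real.rpow_pos_of_pos (hGpos t htI) _
  have hΦ0 : 0 ≤ Φ t y := hΦ.nonneg t y ht.1.le
  have hm0 : 0 ≤ m t := (Real.rpow_nonneg hΦ0 α).trans (hm t y ht.1)
  set lam : ℝ := K + L + 1
  have hκ : 0 ≤ q * Real.exp (lam * t) := by positivity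
  have hwpos : 0 < T t y - β * Φ t y := by
    rw [heq]
    have := one_le_quadWeight y
    positivity
  have hspace := driftLap_le_of_le_quadWeight hu
    ((hT.spaceC2 t ht.1).sub (contDiff_const.mul (hΦ.spaceC2 t ht.1))) hκ (hle t htI) heq
  change driftLap u (fun y => T t y - β * Φ t y) y ≤ K * (T t y - β * Φ t y) at hspace
  rw [driftLap_sub_const_mul u (hT.spaceC2 t ht.1) (hΦ.spaceC2 t ht.1)] at hspace
  have hTd := (hT.timeDiff t y ht.1).hasDerivAt
  have hΦd := (hΦ.timeDiff t y ht.1).hasDerivAt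
  rw [hT.eqn t y ht.1] at hTd
  rw [hΦ.eqn t y ht.1, add_zero] at hΦd
  change HasDerivAt _ (driftLap u (T t) y + f (T t y)) t at hTd
  change HasDerivAt _ (driftLap u (Φ t) y) t at hΦd
  have hGlin : HasDerivAt (fun s => G t + c * α * m t * (t - s)) (-(c * α * m t)) t := by
    simpa using (((hasDerivAt_id t).const_sub t).const_mul (c * α * m t)).const_add (G t)
  have hβd : HasDerivAt (fun s => (G t + c * α * m t * (t - s)) ^ (-(1 / α)))
      (c * β ^ (1 + α) * m t) t := by
    convert hGlin.rpow_const (p := -(1 / α)) (Or.inl (by simpa using (hGpos t htI).ne')) using 1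
    rw [hβ, ← Real.rpow_mul (hGpos t htI).le, sub_self, mul_zero, add_zero]
    have : -(1 / α) * (1 + α) = -(1 / α) - 1 := by
      field_simp
      ring
    rw [this]
    field_simp
  have htime := (hTd.sub (hβd.mul hΦd)).sub
    (((((hasDerivAt_id t).const_mul lam).exp).const_mul q).mul_const (quadWeight y))
  have hnn := deriv_nonneg_of_forall_le_left ht.1 htime (fun s hs => by
    have hsτ : s ∈ Icc 0 τ := ⟨hs.1, hs.2.trans ht.2⟩
    have h1 := hle s hsτ y
    have h2 : G s ^ (-(1 / α)) ≤ (G t + c * α * m t * (t - s)) ^ (-(1 / α)) := by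
      refine Real.rpow_le_rpow_of_nonpos ?_ (hG t htI ht.1 s hs) (by simp [hα.le])
      have := sub_nonneg.2 hs.2
      have := hGpos t htI
      positivity
    have h3 := mul_le_mul_of_nonneg_right h2 (hΦ.nonneg s y hs.1)
    simp only [id, Pi.sub_apply, Pi.mul_apply, sub_self, mul_zero, add_zero] at *
    linarith)
  simp only [id, mul_one, sub_self, mul_zero, add_zero] at hnn
  have hlamw : q * (Real.exp (lam * t) * lam) * quadWeight y
      = lam * (T t y - β * Φ t y) := by
    rw [heq]
    ring
  rw [hlamw, ← hβ] at hnn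
  have hβΦ : 0 ≤ β * Φ t y := mul_nonneg hβ0.le hΦ0
  have hlip : f (T t y) - f (β * Φ t y) ≤ L * (T t y - β * Φ t y) := by
    have hTC : T t y ≤ max C 1 := (hC t y ht.1.le ht.2).trans (le_max_left _ _)
    have := hL.dist_le_mul (T t y) ⟨by linarith, hTC⟩ (β * Φ t y) ⟨hβΦ, by linarith⟩
    rw [Real.dist_eq, Real.dist_eq, abs_of_pos hwpos] at this
    exact (le_abs_self _).trans this
  have hreact : f (β * Φ t y) ≤ c * β ^ (1 + α) * m t * Φ t y := by
    refine (hf_le _ hβΦ).trans ?_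
    rw [Real.mul_rpow hβ0.le hΦ0, Real.rpow_add' hΦ0 (by linarith), Real.rpow_one]
    have := mul_le_mul_of_nonneg_left (hm t y ht.1)
      (show 0 ≤ c * β ^ (1 + α) * Φ t y by positivity)
    nlinarith
  have : lam * (T t y - β * Φ t y) = K * (T t y - β * Φ t y) + L * (T t y - β * Φ t y)
      + (T t y - β * Φ t y) := by
    simp only [lam]
    ring
  linarith

end MaximumPrinciple

/-- The subcritical amplitude may be taken positive. -/
lemma exists_pos_amplitude {c α J δ₀ : ℝ} (hc : 0 < c) (hα : 0 < α) (hJ : 0 ≤ J)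
    (hδ₀ : 0 ≤ δ₀) (hδ : c * α * δ₀ ^ α * J < 1) :
    ∃ δ, 0 < δ ∧ δ₀ ≤ δ ∧ c * α * δ ^ α * J < 1 := by
  rcases hδ₀.eq_or_lt with rfl | hpos
  · have hD : 0 < c * α * J + 1 := by positivity
    refine ⟨(1 / (c * α * J + 1)) ^ α⁻¹, by positivity, by positivity, ?_⟩
    rw [Real.rpow_inv_rpow (by positivity) hα.ne', mul_right_comm, mul_one_div, div_lt_one hD]
    linarith
  · exact ⟨δ₀, hpos, le_rfl, hδ⟩

/-- Meier's lemma, quenching part. Suppose `f(s) ≤ c s^{1+α}` for `s ≥ 0`,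
`Φ` is a bounded nonnegative classical solution of the linear equation `Φ_t = ΔΦ + u·∇Φ`
with initial datum `Φ₀ ≥ 0`, and `I = ∫₀^∞ (sup_x Φ(t,x))^α dt < ∞`. If
`0 ≤ δ₀ < (cαI)^{-1/α}` (equivalently, `cα δ₀^α I < 1`), then every classical solution `T`
of `T_t = ΔT + u·∇T + f(T)` with initial datum `δ₀ Φ₀` quenches. -/
theorem quenching_paper_stmt6
    (N : ℕ) (hN : 1 ≤ N)
    (u : (Fin N → ℝ) → Fin N → ℝ) (hu_cont : Continuous u)
    (hu_bdd : ∃ C : ℝ, ∀ z, ‖u z‖ ≤ C)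
    (f : ℝ → ℝ) (hf0 : f 0 = 0)
    (hf_nonneg : ∀ s : ℝ, 0 ≤ s → 0 ≤ f s)
    (hf_locLip : ∀ R : ℝ, 0 < R → ∃ K, LipschitzOnWith K f (Set.Icc 0 R))
    (c α : ℝ) (hc : 0 < c) (hα : 0 < α)
    (hf_le : ∀ s : ℝ, 0 ≤ s → f s ≤ c * s ^ (1 + α))
    (Φ0 : (Fin N → ℝ) → ℝ) (hΦ0 : ∀ z, 0 ≤ Φ0 z)
    (Φ : ℝ → (Fin N → ℝ) → ℝ)
    (hΦ : IsRDSol N u (fun _ => 0) Φ0 Φ)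
    (hΦ_bdd : ∃ C : ℝ, ∀ t z, 0 ≤ t → Φ t z ≤ C)
    (I : ENNReal)
    (hI : I = ∫⁻ t in Set.Ioi (0:ℝ), ENNReal.ofReal ((⨆ z, Φ t z) ^ α))
    (hI_fin : I ≠ ⊤)
    (δ₀ : ℝ) (hδ₀ : 0 ≤ δ₀) (hδ : c * α * δ₀ ^ α * I.toReal < 1)
    (T : ℝ → (Fin N → ℝ) → ℝ)
    (hT : IsRDSol N u f (fun z => δ₀ * Φ0 z) T) :
    RDQuenches N T := by
  obtain ⟨U, hU⟩ := hu_bdd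
  obtain ⟨C, hC⟩ := hΦ_bdd
  obtain ⟨δ, hδpos, hδle, hδ1⟩ :=
    exists_pos_amplitude hc hα ENNReal.toReal_nonneg hδ₀ hδ
  have hbdd : ∀ t, 0 ≤ t → BddAbove (Set.range (Φ t)) := fun t ht =>
    ⟨C, by rintro _ ⟨z, rfl⟩; exact hC t z ht⟩
  have hsup : ∀ t, 0 ≤ t → ∀ z, Φ t z ≤ ⨆ z, Φ t z := fun t ht z => le_ciSup (hbdd t ht) z
  have hsup0 : ∀ t, 0 ≤ t → 0 ≤ ⨆ z, Φ t z := fun t ht =>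
    (hΦ.nonneg t 0 ht).trans (hsup t ht 0)
  set m : ℝ → ℝ := fun t => (⨆ z, Φ t z) ^ α with hm
  have hm0 : ∀ t, 0 ≤ t → 0 ≤ m t := fun t ht => Real.rpow_nonneg (hsup0 t ht) α
  have hmΦ : ∀ t z, 0 ≤ t → Φ t z ^ α ≤ m t := fun t z ht =>
    Real.rpow_le_rpow (hΦ.nonneg t z ht) (hsup t ht z) hα.le
  have hanti : AntitoneOn m (Ici 0) := fun s hs t ht hst =>
    Real.rpow_le_rpow (hsup0 t ht)
      (ciSup_le fun z => hΦ.le_of_le hU hs (hsup s hs) hst z) hα.le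
  have hae0 : 0 ≤ᵐ[volume.restrict (Ioi (0 : ℝ))] m :=
    (ae_restrict_iff' measurableSet_Ioi).2 (Eventually.of_forall fun t ht => hm0 t (le_of_lt ht))
  have hmeas : AEStronglyMeasurable m (volume.restrict (Ioi (0 : ℝ))) :=
    (aemeasurable_restrict_of_antitoneOn measurableSet_Ioi
      (hanti.mono Ioi_subset_Ici_self)).aestronglyMeasurable
  have hint : IntegrableOn m (Ioi 0) := by
    refine ⟨hmeas, (hasFiniteIntegral_iff_ofReal hae0).2 ?_⟩
    rw [← hI]
    exact hI_fin.lt_top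
  have hIeq : I.toReal = ∫ t in Ioi (0 : ℝ), m t := by
    rw [hI, integral_eq_lintegral_of_nonneg_ae hae0 hmeas]
  have hii : ∀ a b, 0 ≤ a → 0 ≤ b → IntervalIntegrable m volume a b := fun a b ha hb =>
    intervalIntegrable_iff.2 (hint.mono_set fun x hx => (le_min ha hb).trans_lt hx.1)
  have hleI : ∀ t, 0 ≤ t → ∫ s in (0 : ℝ)..t, m s ≤ I.toReal := fun t ht => by
    rw [hIeq, intervalIntegral.integral_of_le ht]
    exact setIntegral_mono_set hint hae0 Ioc_subset_Ioi_self.eventuallyLE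
  have hlow : ∀ s t, 0 ≤ s → s ≤ t → m t * (t - s) ≤ ∫ r in s..t, m r := fun s t hs hst => by
    have h1 := intervalIntegral.integral_mono_on hst intervalIntegrable_const
      (hii s t hs (hs.trans hst))
      (fun r hr => hanti (show r ∈ Ici 0 from hs.trans hr.1) (hs.trans hst) hr.2)
    rw [intervalIntegral.integral_const, smul_eq_mul] at h1
    linarith
  set G : ℝ → ℝ := fun t => δ ^ (-α) - c * α * ∫ s in (0 : ℝ)..t, m s with hG
  set g : ℝ := δ ^ (-α) - c * α * I.toReal with hg
  have hgpos : 0 < g := by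
    have h1 : 0 < δ ^ α := Real.rpow_pos_of_pos hδpos α
    rw [hg, Real.rpow_neg hδpos.le, sub_pos, ← one_div, lt_div_iff₀ h1]
    linarith
  have hGg : ∀ t, 0 ≤ t → g ≤ G t := fun t ht => by
    have := mul_le_mul_of_nonneg_left (hleI t ht) (mul_pos hc hα).le
    simp only [hG, hg]
    linarith
  set B : ℝ := g ^ (-(1 / α)) with hB
  have hBpos : 0 < B := Real.rpow_pos_of_pos hgpos _
  have hG0 : G 0 ^ (-(1 / α)) = δ := by
    simp only [hG, intervalIntegral.integral_same, mul_zero, sub_zero]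
    rw [← Real.rpow_mul hδpos.le]
    have : -α * -(1 / α) = 1 := by field_simp
    rw [this, Real.rpow_one]
  have hbound : ∀ t, 0 < t → ∀ z, T t z ≤ B * Φ t z := fun t ht z => by
    refine (hΦ.le_rpow_mul hU hf_locLip hc hα hf_le hT (m := m) (G := G)
      (fun s y hs => hmΦ s y hs.le) (fun s hs => hgpos.trans_le (hGg s hs.1)) ?_ ?_ ?_ ht z).trans
      ?_
    · refine continuousOn_const.sub (continuousOn_const.mul ?_)
      have := intervalIntegral.continuousOn_primitive_interval' (hii 0 t le_rfl ht.le)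
        left_mem_uIcc
      rwa [uIcc_of_le ht.le] at this
    · intro r hr hr0 s hs
      have h1 := hlow s r hs.1 hs.2
      have h2 := intervalIntegral.integral_add_adjacent_intervals
        (hii 0 s le_rfl hs.1) (hii s r hs.1 hr.1)
      have h3 := mul_le_mul_of_nonneg_left h1 (mul_pos hc hα).le
      simp only [hG]
      rw [← h2]
      linarith
    · intro y
      rw [hG0]
      exact mul_le_mul_of_nonneg_right hδle (hΦ0 y)
    · refine mul_le_mul_of_nonneg_right ?_ (hΦ.nonneg t z ht.le)
      exact Real.rpow_le_rpow_of_nonpos hgpos (hGg t ht.le) (by simp [hα.le])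
  intro ε hε
  have hη : 0 < (ε / B) ^ α := Real.rpow_pos_of_pos (div_pos hε hBpos) α
  refine ⟨max 1 (I.toReal / (ε / B) ^ α), fun t ht z => ?_⟩
  have ht0 : 0 < t := one_pos.trans_le ((le_max_left _ _).trans ht)
  have h1 : I.toReal ≤ t * (ε / B) ^ α :=
    (div_le_iff₀ hη).1 ((le_max_right _ _).trans ht)
  have h2 : m t * t ≤ (ε / B) ^ α * t := by
    have h3 := hlow 0 t le_rfl ht0.le
    have h4 := hleI t ht0.le
    rw [sub_zero] at h3
    linarith
  have h5 : Φ t z ≤ ε / B :=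
    (Real.rpow_le_rpow_iff (hΦ.nonneg t z ht0.le) (div_pos hε hBpos).le hα).1
      ((hmΦ t z ht0.le).trans (le_of_mul_le_mul_right h2 ht0))
  calc T t z ≤ B * Φ t z := hbound t ht0 z
    _ ≤ B * (ε / B) := by gcongr
    _ = ε := mul_div_cancel₀ ε hBpos.ne'
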